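/- Under the hypotheses of the invariant-region lemma (a C¹ solution (h,u) of the diagonalized radially symmetric Euler system on (0,∞)×(0,T) with h>0 for r>0, h(0,t)=u(0,t)=0, backward characteristics staying in {r>0}, and initial data satisfying 0 ≤ z₀ < w₀ ≤ 2C₀ on r>0), one has 0 < (2/(γ−1))h(r,t) ≤ u(r,t) ≤ 2C₀ for all r>0 and 0<t<T. -/

import Mathlib

/-- The derivative of `F` along the curve `t ↦ (r t, t)`, in terms of partial derivatives. -/
theorem hasDerivAt_along_curve {F : ℝ → ℝ → ℝ} {r : ℝ → ℝ} {c t : ℝ}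
    (hF : DifferentiableAt ℝ (fun p : ℝ × ℝ => F p.1 p.2) (r t, t)) (hr : HasDerivAt r c t) :
    HasDerivAt (fun τ => F (r τ) τ)
      (deriv (fun τ => F (r t) τ) t + c * deriv (fun s => F s t) (r t)) t := by
  have hL := hF.hasFDerivAt
  have htime : HasDerivAt (fun τ => F (r t) τ) _ t :=
    hL.comp_hasDerivAt_of_eq t ((hasDerivAt_const t (r t)).prodMk (hasDerivAt_id t)) rfl
  have hspace : HasDerivAt (fun s => F s t) _ (r t) :=
    hL.comp_hasDerivAt_of_eq (r t) ((hasDerivAt_id (r t)).prodMk (hasDerivAt_const (r t) t)) rfl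
  have hcurve : HasDerivAt (fun τ => F (r τ) τ) _ t :=
    hL.comp_hasDerivAt_of_eq t (hr.prodMk (hasDerivAt_id t)) rfl
  refine hcurve.congr_deriv ?_
  rw [htime.deriv, hspace.deriv, ← smul_eq_mul c, ← map_smul, ← map_add]
  simp

/-- A function which is nonnegative at `0` and satisfies `z' ≥ M z` wherever it is negative
stays nonnegative. -/
theorem nonneg_of_deriv_ge_mul_of_neg {z z' : ℝ → ℝ} {b M : ℝ} (hb : 0 ≤ b)
    (hz : ContinuousOn z (Set.Icc 0 b)) (h0 : 0 ≤ z 0)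
    (hd : ∀ t ∈ Set.Ioo 0 b, HasDerivAt z (z' t) t)
    (hge : ∀ t ∈ Set.Ioo 0 b, z t < 0 → M * z t ≤ z' t) : 0 ≤ z b := by
  obtain ⟨t₀, ⟨ht₀, hzt₀⟩, hmax⟩ :=
    (isCompact_Icc.of_isClosed_subset (hz.preimage_isClosed_of_isClosed isClosed_Icc isClosed_Ici)
      Set.inter_subset_left : IsCompact (Set.Icc 0 b ∩ z ⁻¹' Set.Ici 0)).exists_isGreatest
      ⟨0, ⟨le_rfl, hb⟩, h0⟩
  have hneg : ∀ t ∈ Set.Ioo t₀ b, z t < 0 := fun t ht => by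
    by_contra! h
    exact absurd (hmax ⟨⟨ht₀.1.trans ht.1.le, ht.2.le⟩, h⟩) (not_le.2 ht.1)
  have hderiv : ∀ t ∈ Set.Ioo t₀ b, HasDerivAt (fun t => z t * Real.exp (-(M * t)))
      ((z' t - M * z t) * Real.exp (-(M * t))) t := fun t ht => by
    have hlin : HasDerivAt (fun t => -(M * t)) (-(M * 1)) t :=
      ((hasDerivAt_id t).const_mul M).neg
    exact ((hd t ⟨ht₀.1.trans_lt ht.1, ht.2⟩).mul hlin.exp).congr_deriv (by ring)
  have hmono : MonotoneOn (fun t => z t * Real.exp (-(M * t))) (Set.Icc t₀ b) := by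
    refine monotoneOn_of_deriv_nonneg (convex_Icc _ _) ?_ ?_ ?_
    · exact (hz.mono (Set.Icc_subset_Icc_left ht₀.1)).mul (by fun_prop)
    · rw [interior_Icc]
      exact fun t ht => (hderiv t ht).differentiableAt.differentiableWithinAt
    · rw [interior_Icc]
      intro t ht
      rw [(hderiv t ht).deriv]
      exact mul_nonneg (sub_nonneg.2 (hge t ⟨ht₀.1.trans_lt ht.1, ht.2⟩ (hneg t ht)))
        (Real.exp_pos _).le
  have hle := hmono (Set.left_mem_Icc.2 ht₀.2) (Set.right_mem_Icc.2 ht₀.2) ht₀.2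
  exact nonneg_of_mul_nonneg_left ((mul_nonneg hzt₀ (Real.exp_pos _).le).trans hle)
    (Real.exp_pos _)


/-- **Propagated supersonic `L^∞` bounds.**
Under the hypotheses of the invariant-region lemma (a C¹ solution `(h,u)` of the
diagonalized radially symmetric Euler system on `(0,∞)×(0,T)` with `h > 0` for `r > 0`,
`h(0,t) = u(0,t) = 0`, backward characteristics staying in `{r > 0}`, and initial data
with `0 ≤ z₀ < w₀ ≤ 2C₀`), one has `0 < (2/(γ−1))h ≤ u ≤ 2C₀` for `r > 0`, `0 < t < T`. -/
theorem supersonic_bounds_propagate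
    (γ : ℝ) (d : ℕ) (C0 T : ℝ)
    (hγ : 1 < γ) (hd : d = 1 ∨ d = 2 ∨ d = 3) (hC0 : 0 < C0) (hT : 0 < T)
    (u h : ℝ → ℝ → ℝ)
    (hC1 : ContDiffOn ℝ 1 (fun p : ℝ × ℝ => (u p.1 p.2, h p.1 p.2))
      (Set.Ioi (0:ℝ) ×ˢ Set.Ioo (0:ℝ) T))
    (hcont : ContinuousOn (fun p : ℝ × ℝ => (u p.1 p.2, h p.1 p.2))
      (Set.Ici (0:ℝ) ×ˢ Set.Ico (0:ℝ) T))
    (hpos : ∀ r t, 0 < r → 0 < t → t < T → 0 < h r t)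
    (hbdry : ∀ t, 0 ≤ t → t < T → h 0 t = 0 ∧ u 0 t = 0)
    (hpde_w : ∀ r t, 0 < r → 0 < t → t < T →
      deriv (fun τ => u r τ + 2 / (γ - 1) * h r τ) t
        + (u r t + h r t) * deriv (fun s => u s t + 2 / (γ - 1) * h s t) r
        = -(((d : ℝ) - 1) / r) * u r t * h r t)
    (hpde_z : ∀ r t, 0 < r → 0 < t → t < T →
      deriv (fun τ => u r τ - 2 / (γ - 1) * h r τ) t
        + (u r t - h r t) * deriv (fun s => u s t - 2 / (γ - 1) * h s t) r
        = ((d : ℝ) - 1) / r * u r t * h r t)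
    (hchar : ∀ rbar tbar, 0 < rbar → 0 < tbar → tbar < T →
      (∃ r1 : ℝ → ℝ, r1 tbar = rbar ∧ ∀ t ∈ Set.Icc 0 tbar,
          0 < r1 t ∧ HasDerivAt r1 (u (r1 t) t - h (r1 t) t) t) ∧
      (∃ r2 : ℝ → ℝ, r2 tbar = rbar ∧ ∀ t ∈ Set.Icc 0 tbar,
          0 < r2 t ∧ HasDerivAt r2 (u (r2 t) t + h (r2 t) t) t))
    (hinit : ∀ r, 0 < r →
      0 ≤ u r 0 - 2 / (γ - 1) * h r 0 ∧
      u r 0 - 2 / (γ - 1) * h r 0 < u r 0 + 2 / (γ - 1) * h r 0 ∧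
      u r 0 + 2 / (γ - 1) * h r 0 ≤ 2 * C0) :
    ∀ r t, 0 < r → 0 < t → t < T →
      0 < 2 / (γ - 1) * h r t ∧ 2 / (γ - 1) * h r t ≤ u r t ∧ u r t ≤ 2 * C0 := by
  have hκ : 0 < 2 / (γ - 1) := div_pos two_pos (sub_pos.2 hγ)
  set κ := 2 / (γ - 1)
  have hd1 : (0 : ℝ) ≤ (d : ℝ) - 1 := by
    rcases hd with rfl | rfl | rfl <;> norm_num
  have hdiff : ∀ r t, 0 < r → 0 < t → t < T →
      DifferentiableAt ℝ (fun p : ℝ × ℝ => u p.1 p.2) (r, t) ∧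
      DifferentiableAt ℝ (fun p : ℝ × ℝ => h p.1 p.2) (r, t) := fun r t hr h0 h1 => by
    have hp := (hC1.contDiffAt (x := (r, t))
      ((isOpen_Ioi.prod isOpen_Ioo).mem_nhds ⟨hr, h0, h1⟩)).differentiableAt one_ne_zero
    exact ⟨hp.fst, hp.snd⟩
  have hcurve : ∀ (ρ : ℝ → ℝ) (b : ℝ), b < T → ContinuousOn ρ (Set.Icc 0 b) →
      (∀ t ∈ Set.Icc 0 b, 0 < ρ t) →
      ContinuousOn (fun t => u (ρ t) t) (Set.Icc 0 b) ∧
      ContinuousOn (fun t => h (ρ t) t) (Set.Icc 0 b) := fun ρ b hb hρ hρ0 => by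
    have hc := hcont.comp (hρ.prodMk continuousOn_id)
      fun t ht => ⟨(hρ0 t ht).le, ht.1, ht.2.trans_lt hb⟩
    exact ⟨hc.fst, hc.snd⟩
  have hz : ∀ r t, 0 < r → 0 < t → t < T → 0 ≤ u r t - κ * h r t := by
    intro r b hr hb hbT
    obtain ⟨⟨ρ, hρb, hρ⟩, -⟩ := hchar r b hr hb hbT
    have hρc : ContinuousOn ρ (Set.Icc 0 b) :=
      fun t ht => (hρ t ht).2.continuousAt.continuousWithinAt
    obtain ⟨huc, hhc⟩ := hcurve ρ b hbT hρc fun t ht => (hρ t ht).1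
    obtain ⟨M, hM⟩ := isCompact_Icc.bddAbove_image
      (f := fun t => ((d : ℝ) - 1) / ρ t * h (ρ t) t)
      ((continuousOn_const.div hρc fun t ht => (hρ t ht).1.ne').mul hhc)
    rw [← hρb]
    refine nonneg_of_deriv_ge_mul_of_neg (z := fun t => u (ρ t) t - κ * h (ρ t) t)
      (z' := fun t => ((d : ℝ) - 1) / ρ t * u (ρ t) t * h (ρ t) t) (M := M) hb.le
      (huc.sub (continuousOn_const.mul hhc))
      (hinit _ (hρ 0 ⟨le_rfl, hb.le⟩).1).1 ?_ ?_
    · intro t ht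
      obtain ⟨hρ0, hρd⟩ := hρ t (Set.Ioo_subset_Icc_self ht)
      obtain ⟨hu, hh⟩ := hdiff _ t hρ0 ht.1 (ht.2.trans hbT)
      rw [← hpde_z _ t hρ0 ht.1 (ht.2.trans hbT)]
      exact hasDerivAt_along_curve (F := fun r t => u r t - κ * h r t)
        (hu.sub (hh.const_mul κ)) hρd
    · intro t ht hneg
      have hρ0 := (hρ t (Set.Ioo_subset_Icc_self ht)).1
      have hh := hpos _ t hρ0 ht.1 (ht.2.trans hbT)
      have ha : 0 ≤ ((d : ℝ) - 1) / ρ t * h (ρ t) t :=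
        mul_nonneg (div_nonneg hd1 hρ0.le) hh.le
      have haM : ((d : ℝ) - 1) / ρ t * h (ρ t) t ≤ M :=
        hM ⟨t, Set.Ioo_subset_Icc_self ht, rfl⟩
      calc M * (u (ρ t) t - κ * h (ρ t) t)
          ≤ ((d : ℝ) - 1) / ρ t * h (ρ t) t * (u (ρ t) t - κ * h (ρ t) t) :=
            mul_le_mul_of_nonpos_right haM hneg.le
        _ ≤ ((d : ℝ) - 1) / ρ t * h (ρ t) t * u (ρ t) t :=
            mul_le_mul_of_nonneg_left (sub_le_self _ (mul_pos hκ hh).le) ha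
        _ = ((d : ℝ) - 1) / ρ t * u (ρ t) t * h (ρ t) t := by ring
  have hw : ∀ r t, 0 < r → 0 < t → t < T → u r t + κ * h r t ≤ 2 * C0 := by
    intro r b hr hb hbT
    obtain ⟨-, ρ, hρb, hρ⟩ := hchar r b hr hb hbT
    obtain ⟨huc, hhc⟩ := hcurve ρ b hbT
      (fun t ht => (hρ t ht).2.continuousAt.continuousWithinAt) fun t ht => (hρ t ht).1
    rw [← hρb, ← sub_nonneg]
    refine nonneg_of_deriv_ge_mul_of_neg (z := fun t => 2 * C0 - (u (ρ t) t + κ * h (ρ t) t))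
      (z' := fun t => -(-(((d : ℝ) - 1) / ρ t) * u (ρ t) t * h (ρ t) t)) (M := 0) hb.le
      (continuousOn_const.sub (huc.add (continuousOn_const.mul hhc)))
      (sub_nonneg.2 (hinit _ (hρ 0 ⟨le_rfl, hb.le⟩).1).2.2) ?_ ?_
    · intro t ht
      obtain ⟨hρ0, hρd⟩ := hρ t (Set.Ioo_subset_Icc_self ht)
      obtain ⟨hu, hh⟩ := hdiff _ t hρ0 ht.1 (ht.2.trans hbT)
      rw [← hpde_w _ t hρ0 ht.1 (ht.2.trans hbT)]
      exact (hasDerivAt_along_curve (F := fun r t => u r t + κ * h r t)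
        (hu.add (hh.const_mul κ)) hρd).const_sub (2 * C0)
    · intro t ht _
      have hρ0 := (hρ t (Set.Ioo_subset_Icc_self ht)).1
      have hh := hpos _ t hρ0 ht.1 (ht.2.trans hbT)
      have hu : 0 ≤ u (ρ t) t :=
        (mul_pos hκ hh).le.trans (sub_nonneg.1 (hz _ t hρ0 ht.1 (ht.2.trans hbT)))
      rw [zero_mul, neg_mul, neg_mul, neg_neg]
      exact mul_nonneg (mul_nonneg (div_nonneg hd1 hρ0.le) hu) hh.le
  intro r t hr ht htT
  have hh := mul_pos hκ (hpos r t hr ht htT)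
  exact ⟨hh, sub_nonneg.1 (hz r t hr ht htT),
    (le_add_of_nonneg_right hh.le).trans (hw r t hr ht htT)⟩
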